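/- Let a ≥ 2 be an integer and set n_j = a^{j−1} for j ≥ 1. Then the sequence (n_j) has rational spectrum; explicitly, for every α ∈ S¹ that is not a root of unity and every m ∈ ℕ, lim_{d→∞} ∏_{j=m}^{d} (1 + α^{a^{j−1}})/2 = 0. -/

import Mathlib

open MeasureTheory Filter Finset

/-- The spectrum of a sequence of natural numbers: the subgroup of the circle generated by
the complement of `⋂_m {α : ∏_{j=m}^d (1+α^{n_j})/2 → 0 as d → ∞}`. -/
noncomputable def ipSpectrum (n : ℕ → ℕ) : Subgroup Circle :=
  Subgroup.closure {α : Circle |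
    ¬ ∀ m : ℕ, Filter.Tendsto
      (fun d : ℕ => ∏ j ∈ Finset.Icc m d, ((1 + (α : ℂ) ^ n j) / 2))
      Filter.atTop (nhds 0)}

/-- A sequence has rational spectrum if its spectrum is contained in
`{e^{2πiq} : q ∈ ℚ}`. -/
def HasRationalSpectrum (n : ℕ → ℕ) : Prop :=
  ∀ α : Circle, α ∈ ipSpectrum n →
    ∃ q : ℚ, (α : ℂ) = Complex.exp (2 * Real.pi * q * Complex.I)


lemma gs_aux (β : ℕ → ℂ) (a : ℕ) (ha : 2 ≤ a) (hs : ∀ j, 1 ≤ j → β (j + 1) = β j ^ a)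
    (h1 : Tendsto β atTop (nhds 1)) : ∃ j, 1 ≤ j ∧ β j = 1 := by
  have hsum : Tendsto (fun j => ‖∑ i ∈ Finset.range a, β j ^ i‖) atTop (nhds (a : ℝ)) := by
    have h := (tendsto_finsetSum (Finset.range a) (fun i _ => h1.pow i)).norm
    simpa using h
  have h2 : (1 : ℝ) < a := by exact_mod_cast ha
  obtain ⟨N, hN⟩ := eventually_atTop.1 (hsum.eventually (lt_mem_nhds h2))
  set M := N + 1
  refine ⟨M, by omega, ?_⟩
  have hmono : ∀ k, ‖β M - 1‖ ≤ ‖β (M + k) - 1‖ := by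
    intro k
    induction k with
    | zero => simp
    | succ k ih =>
      refine ih.trans ?_
      rw [← add_assoc, hs (M + k) (by omega), ← geom_sum_mul, norm_mul]
      exact le_mul_of_one_le_left (norm_nonneg _) (hN (M + k) (by omega)).le
  have hlim : Tendsto (fun k => ‖β (M + k) - 1‖) atTop (nhds 0) := by
    have h3 : Tendsto (fun j => ‖β j - 1‖) atTop (nhds 0) := by
      simpa using (h1.sub_const 1).norm
    exact h3.comp (tendsto_atTop_mono (fun k => Nat.le_add_left k M) tendsto_id)
  have h4 : ‖β M - 1‖ ≤ 0 := ge_of_tendsto' hlim hmono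
  exact sub_eq_zero.1 (norm_le_zero_iff.1 h4)

lemma gs_aux2 (β : ℕ → ℂ) (hβ : ∀ j, ‖β j‖ = 1) (m : ℕ)
    (hn : ¬ Tendsto (fun d : ℕ => ∏ j ∈ Finset.Icc m d, ((1 + β j) / 2)) atTop (nhds 0)) :
    Tendsto β atTop (nhds 1) := by
  set f : ℕ → ℝ := fun j => ‖(1 + β j) / 2‖ with hf
  have hf1 : ∀ j, f j ≤ 1 := by
    intro j
    have := norm_add_le (1 : ℂ) (β j)
    rw [hβ, norm_one] at this
    simp only [hf, norm_div, Complex.norm_ofNat]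
    linarith
  have hf0 : ∀ j, 0 ≤ f j := fun j => norm_nonneg _
  set P : ℕ → ℝ := fun k => ∏ j ∈ Finset.Icc m (m + k), f j with hP
  have hPs : ∀ k, P (k + 1) = P k * f (m + k + 1) := by
    intro k
    simp only [hP]
    rw [← add_assoc, Finset.prod_Icc_succ_top (by omega)]
  have hP0 : ∀ k, 0 ≤ P k := fun k => Finset.prod_nonneg fun j _ => hf0 j
  have hanti : Antitone P := antitone_nat_of_succ_le fun k => by
    rw [hPs]; exact mul_le_of_le_one_right (hP0 k) (hf1 _)
  have hL := tendsto_atTop_ciInf hanti ⟨0, by rintro _ ⟨k, rfl⟩; exact hP0 k⟩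
  set L := ⨅ k, P k
  have hL0 : L ≠ 0 := by
    intro h0
    apply hn
    rw [tendsto_zero_iff_norm_tendsto_zero]
    rw [← tendsto_add_atTop_iff_nat m]
    rw [h0] at hL
    refine hL.congr fun k => ?_
    simp only [hP, hf, norm_prod, add_comm m k]
  have hLp : 0 < L := lt_of_le_of_ne (ge_of_tendsto' hL hP0) hL0.symm
  have hPp : ∀ k, 0 < P k := fun k => hLp.trans_le (hanti.le_of_tendsto hL k)
  have hft : Tendsto (fun k => f (k + (m + 1))) atTop (nhds 1) := by
    have h := (hL.comp (tendsto_add_atTop_nat 1)).div hL hL0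
    rw [div_self hL0] at h
    refine h.congr fun k => ?_
    have := (hPp k).ne'
    simp only [Pi.div_apply, Function.comp, hPs]
    rw [mul_div_cancel_left₀ _ this]
    congr 1; omega
  have hft := (tendsto_add_atTop_iff_nat (m + 1)).1 hft
  have hpar : ∀ j, ‖β j - 1‖ = Real.sqrt (4 - 4 * f j ^ 2) := by
    intro j
    have h := parallelogram_law_with_norm ℝ (β j) 1
    rw [hβ, norm_one] at h
    have h5 : ‖β j + 1‖ = 2 * f j := by
      simp only [hf, norm_div, Complex.norm_ofNat, add_comm (1 : ℂ)]
      ring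
    rw [h5] at h
    rw [show 4 - 4 * f j ^ 2 = ‖β j - 1‖ ^ 2 by nlinarith, Real.sqrt_sq (norm_nonneg _)]
  have : Tendsto (fun j => ‖β j - 1‖) atTop (nhds 0) := by
    simp_rw [hpar]
    have h := (((hft.pow 2).const_mul 4).const_sub 4).sqrt
    simpa using h
  exact tendsto_iff_norm_sub_tendsto_zero.2 this

lemma gs_main (a : ℕ) (ha : 2 ≤ a) (α : ℂ) (hα : ‖α‖ = 1) (hr : ∀ k : ℕ, 0 < k → α ^ k ≠ 1)
    (m : ℕ) : Tendsto (fun d : ℕ => ∏ j ∈ Finset.Icc m d, ((1 + α ^ (a ^ (j - 1))) / 2))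
        atTop (nhds 0) := by
  by_contra hn
  have h1 := gs_aux2 (fun j => α ^ (a ^ (j - 1))) (fun j => by simp [hα]) m hn
  obtain ⟨j, hj, h⟩ := gs_aux _ a ha (fun j hj => by
    obtain ⟨i, rfl⟩ := Nat.exists_eq_add_of_le' hj
    simp [← pow_mul, pow_succ]) h1
  exact hr _ (by positivity) h

/-- for an integer `a ≥ 2`, the sequence `n_j = a^{j-1}` has rational
spectrum; explicitly, for every `α` on the unit circle that is not a root of unity and
every `m`, `∏_{j=m}^d (1+α^{a^{j-1}})/2 → 0` as `d → ∞`. -/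
theorem geometric_sequence_hasRationalSpectrum (a : ℕ) (ha : 2 ≤ a) :
    HasRationalSpectrum (fun j => a ^ (j - 1)) ∧
    ∀ α : ℂ, ‖α‖ = 1 → (∀ k : ℕ, 0 < k → α ^ k ≠ 1) →
      ∀ m : ℕ, Tendsto (fun d : ℕ => ∏ j ∈ Finset.Icc m d, ((1 + α ^ (a ^ (j - 1))) / 2))
        atTop (nhds 0) := by
  refine ⟨fun α hα => ?_, gs_main a ha⟩
  have hle : ipSpectrum (fun j => a ^ (j - 1)) ≤ CommGroup.torsion Circle := by
    refine (Subgroup.closure_le _).2 fun x hx => ?_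
    by_contra hx2
    refine hx fun m => gs_main a ha x (Circle.norm_coe x) (fun k hk h => hx2 ?_) m
    exact isOfFinOrder_iff_pow_eq_one.2 ⟨k, hk, by ext; simpa using h⟩
  obtain ⟨k, hk, h⟩ := isOfFinOrder_iff_pow_eq_one.1 (hle hα)
  have h2 : (α : ℂ) ^ k = 1 := by rw [← Circle.coe_pow, h, Circle.coe_one]
  haveI : NeZero k := ⟨hk.ne'⟩
  have hu : Units.mk0 (α : ℂ) (by simp) ∈ rootsOfUnity k ℂ := by
    rw [mem_rootsOfUnity]; ext; simpa using h2
  obtain ⟨i, -, hi⟩ := (Complex.mem_rootsOfUnity k _).1 hu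
  refine ⟨(i : ℚ) / k, ?_⟩
  rw [Units.val_mk0] at hi
  rw [← hi]
  congr 1
  push_cast
  ring
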